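/- Let Σ be a topological Markov shift and let r: Σ → (0,∞) be Hölder continuous and bounded away from zero and infinity. Then there exist constants C₂ > 0 and κ ∈ (0,1), depending only on r, such that for all z = (x,t) and w = (y,s) in Σ_r: (a) if |t/r(x) − s/r(y)| ≤ 1/2, then d(x,y) ≤ C₂·d_r(z,w) and |s − t| ≤ C₂·d_r(z,w)^κ; (b) if t/r(x) − s/r(y) > 1/2, then d(σ(x), y) ≤ C₂·d_r(z,w), |t − r(x)| ≤ C₂·d_r(z,w), and s ≤ C₂·d_r(z,w). -/

import Mathlib

/-- The topological Markov shift: bi-infinite paths of the directed graph with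
vertex set `V` and edge relation `E`. -/
abbrev TMS (V : Type) (E : V → V → Prop) : Type :=
  {x : ℤ → V // ∀ i : ℤ, E (x i) (x (i + 1))}

/-- The `n`-th power of the left shift map (`n ∈ ℤ`); `shiftZ 1` is the left shift `σ`. -/
def shiftZ {V : Type} {E : V → V → Prop} (n : ℤ) (x : TMS V E) : TMS V E :=
  ⟨fun i => x.1 (i + n), fun i => by
    have h := x.2 (i + n)
    have e : i + n + 1 = i + 1 + n := by ring
    rw [e] at h
    exact h⟩

open Classical in
/-- The metric `d(u,v) = exp (-min {|n| : uₙ ≠ vₙ})` on the topological Markov shift. -/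
noncomputable def tmsDist {V : Type} {E : V → V → Prop} (x y : TMS V E) : ℝ :=
  if x = y then 0
  else Real.exp (-((sInf {k : ℕ | ∃ n : ℤ, n.natAbs = k ∧ x.1 n ≠ y.1 n} : ℕ) : ℝ))

/-- The unit suspension space `Σ_1 = {(x,t) : x ∈ Σ, 0 ≤ t < 1}`. -/
def Sigma1 (V : Type) (E : V → V → Prop) : Type :=
  {p : TMS V E × ℝ // 0 ≤ p.2 ∧ p.2 < 1}

/-- The suspension flow `ψ^τ (x,t) = (σ^n x, t + τ - n)` for the unique `n ∈ ℤ` with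
`0 ≤ t + τ - n < 1`, namely `n = ⌊t + τ⌋`. -/
noncomputable def susp {V : Type} {E : V → V → Prop} (τ : ℝ) (z : Sigma1 V E) :
    Sigma1 V E :=
  ⟨(shiftZ ⌊z.1.2 + τ⌋ z.1.1, Int.fract (z.1.2 + τ)),
    Int.fract_nonneg _, Int.fract_lt_one _⟩

/-- Length of the horizontal segment `[z,w]_h` (for `z, w` of the same height `t`):
`(1-t)·d(x,y) + t·d(σx, σy)`. -/
noncomputable def hlen {V : Type} {E : V → V → Prop} (z w : Sigma1 V E) : ℝ :=
  (1 - z.1.2) * tmsDist z.1.1 w.1.1 + z.1.2 * tmsDist (shiftZ 1 z.1.1) (shiftZ 1 w.1.1)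

/-- Length of the vertical segment `[z,w]_v`: `inf {|t| : w = ψ^t z}`. -/
noncomputable def vlen {V : Type} {E : V → V → Prop} (z w : Sigma1 V E) : ℝ :=
  sInf {c : ℝ | ∃ t : ℝ, susp t z = w ∧ c = |t|}

/-- Admissible costs of a single step of a basic path from `z` to `w`: either `z, w`
form a horizontal segment (same height) of length `hlen z w`, or a vertical segment
(`w = ψ^t z` for some `t`) of length `vlen z w`. -/
def stepCost {V : Type} {E : V → V → Prop} (z w : Sigma1 V E) : Set ℝ :=
  {c | (z.1.2 = w.1.2 ∧ c = hlen z w) ∨ ((∃ t : ℝ, susp t z = w) ∧ c = vlen z w)}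

/-- The set of lengths of basic paths from `z` to `w`. -/
def pathCosts {V : Type} {E : V → V → Prop} (z w : Sigma1 V E) : Set ℝ :=
  {c | ∃ (n : ℕ) (zs : ℕ → Sigma1 V E) (cs : ℕ → ℝ),
    zs 0 = z ∧ zs n = w ∧ (∀ i < n, cs i ∈ stepCost (zs i) (zs (i + 1))) ∧
    c = ∑ i ∈ Finset.range n, cs i}

/-- The Bowen–Walters metric on `Σ_1`: infimum of lengths of basic paths. -/
noncomputable def d1 {V : Type} {E : V → V → Prop} (z w : Sigma1 V E) : ℝ :=
  sInf (pathCosts z w)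

/-- The phase space `Σ_r = {(x,t) : x ∈ Σ, 0 ≤ t < r(x)}` of the topological Markov flow. -/
def SigmaR (V : Type) (E : V → V → Prop) (r : TMS V E → ℝ) : Type :=
  {p : TMS V E × ℝ // 0 ≤ p.2 ∧ p.2 < r p.1}

open Classical in
/-- The canonical bijection `ϑ_r : Σ_r → Σ_1`, `ϑ_r(x,t) = (x, t/r(x))`
(junk value if `r(x) ≤ 0`). -/
noncomputable def thetaR {V : Type} {E : V → V → Prop} (r : TMS V E → ℝ)
    (z : SigmaR V E r) : Sigma1 V E :=
  if h : 0 < r z.1.1 then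
    ⟨(z.1.1, z.1.2 / r z.1.1), div_nonneg z.2.1 h.le, (div_lt_one h).2 z.2.2⟩
  else ⟨(z.1.1, 0), le_refl 0, zero_lt_one⟩

/-- The Bowen–Walters distance on `Σ_r`: `d_r(z,w) = d_1(ϑ_r z, ϑ_r w)`. -/
noncomputable def dr {V : Type} {E : V → V → Prop} (r : TMS V E → ℝ)
    (z w : SigmaR V E r) : ℝ :=
  d1 (thetaR r z) (thetaR r w)

section BowenWalters

open Filter Topology

variable {V : Type} {E : V → V → Prop}

theorem shiftZ_shiftZ (m n : ℤ) (x : TMS V E) :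
    shiftZ m (shiftZ n x) = shiftZ (m + n) x := by
  apply Subtype.ext
  funext i
  simp only [shiftZ, add_assoc]

theorem shiftZ_zero (x : TMS V E) : shiftZ 0 x = x := by
  apply Subtype.ext
  funext i
  simp [shiftZ]

theorem tmsDist_self (x : TMS V E) : tmsDist x x = 0 := by
  simp [tmsDist]

theorem tmsDist_nonneg (x y : TMS V E) : 0 ≤ tmsDist x y := by
  unfold tmsDist
  split_ifs
  · exact le_rfl
  · positivity

theorem tmsDist_le_one (x y : TMS V E) : tmsDist x y ≤ 1 := by
  unfold tmsDist
  split_ifs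
  · exact zero_le_one
  · rw [Real.exp_le_one_iff, neg_nonpos]
    positivity

theorem exp_neg_natAbs_le_tmsDist {x y : TMS V E} {n : ℤ} (h : x.1 n ≠ y.1 n) :
    Real.exp (-(n.natAbs : ℝ)) ≤ tmsDist x y := by
  have hne : x ≠ y := fun e => h (by rw [e])
  rw [tmsDist, if_neg hne, Real.exp_le_exp, neg_le_neg_iff, Nat.cast_le]
  exact Nat.sInf_le ⟨n, rfl, h⟩

theorem exists_tmsDist_eq {x y : TMS V E} (h : x ≠ y) :
    ∃ n : ℤ, x.1 n ≠ y.1 n ∧ tmsDist x y = Real.exp (-(n.natAbs : ℝ)) := by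
  obtain ⟨i, hi⟩ : ∃ i, x.1 i ≠ y.1 i := by
    by_contra! hc
    exact h (Subtype.ext (funext hc))
  obtain ⟨n, hn, hxy⟩ := Nat.sInf_mem
    (s := {k : ℕ | ∃ n : ℤ, n.natAbs = k ∧ x.1 n ≠ y.1 n}) ⟨_, i, rfl, hi⟩
  exact ⟨n, hxy, by rw [tmsDist, if_neg h, hn]⟩

theorem tmsDist_triangle (x y z : TMS V E) :
    tmsDist x z ≤ tmsDist x y + tmsDist y z := by
  by_cases h : x = z
  · rw [h, tmsDist_self]
    exact add_nonneg (tmsDist_nonneg _ _) (tmsDist_nonneg _ _)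
  obtain ⟨n, hn, hd⟩ := exists_tmsDist_eq h
  rw [hd]
  by_cases hxy : x.1 n = y.1 n
  · have := exp_neg_natAbs_le_tmsDist (x := y) (y := z) (n := n) (hxy ▸ hn)
    linarith [tmsDist_nonneg x y]
  · have := exp_neg_natAbs_le_tmsDist hxy
    linarith [tmsDist_nonneg y z]

theorem tmsDist_shiftZ_le (k : ℤ) (x y : TMS V E) :
    tmsDist (shiftZ k x) (shiftZ k y) ≤ Real.exp (k.natAbs : ℝ) * tmsDist x y := by
  by_cases h : shiftZ k x = shiftZ k y
  · rw [h, tmsDist_self]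
    exact mul_nonneg (Real.exp_pos _).le (tmsDist_nonneg _ _)
  obtain ⟨n, hn, hd⟩ := exists_tmsDist_eq h
  have h1 := exp_neg_natAbs_le_tmsDist (x := x) (y := y) (n := n + k) hn
  have h2 : ((n + k).natAbs : ℝ) ≤ n.natAbs + k.natAbs := by
    exact_mod_cast Int.natAbs_add_le n k
  calc tmsDist (shiftZ k x) (shiftZ k y) = Real.exp (-(n.natAbs : ℝ)) := hd
    _ ≤ Real.exp (k.natAbs + -((n + k).natAbs : ℝ)) := Real.exp_le_exp.2 (by linarith)
    _ = Real.exp (k.natAbs : ℝ) * Real.exp (-((n + k).natAbs : ℝ)) := Real.exp_add _ _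
    _ ≤ _ := by gcongr

theorem tmsDist_shiftZ_le_of_natAbs_le_one {k : ℤ} (hk : k.natAbs ≤ 1) (x y : TMS V E) :
    tmsDist (shiftZ k x) (shiftZ k y) ≤ Real.exp 1 * tmsDist x y := by
  refine (tmsDist_shiftZ_le k x y).trans ?_
  have : (k.natAbs : ℝ) ≤ 1 := by exact_mod_cast hk
  gcongr
  exact tmsDist_nonneg _ _

theorem hlen_nonneg (z w : Sigma1 V E) : 0 ≤ hlen z w :=
  add_nonneg (mul_nonneg (by linarith [z.2.2]) (tmsDist_nonneg _ _))
    (mul_nonneg z.2.1 (tmsDist_nonneg _ _))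

theorem tmsDist_le_exp_mul_hlen (z w : Sigma1 V E) :
    tmsDist z.1.1 w.1.1 ≤ Real.exp 1 * hlen z w := by
  have h := tmsDist_shiftZ_le_of_natAbs_le_one (k := -1) le_rfl
    (shiftZ 1 z.1.1) (shiftZ 1 w.1.1)
  rw [shiftZ_shiftZ, shiftZ_shiftZ, neg_add_cancel, shiftZ_zero, shiftZ_zero] at h
  have h1 : tmsDist z.1.1 w.1.1 ≤ Real.exp 1 * tmsDist z.1.1 w.1.1 :=
    le_mul_of_one_le_left (tmsDist_nonneg _ _) (Real.one_le_exp zero_le_one)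
  have h2 := mul_le_mul_of_nonneg_left h z.2.1
  have h3 := mul_le_mul_of_nonneg_left h1 (sub_nonneg.2 z.2.2.le)
  unfold hlen
  linarith

theorem exists_abs_lt_vlen_add {z w : Sigma1 V E} (h : ∃ t : ℝ, susp t z = w) {η : ℝ}
    (hη : 0 < η) : ∃ t : ℝ, susp t z = w ∧ |t| < vlen z w + η := by
  obtain ⟨t, ht⟩ := h
  obtain ⟨_, ⟨s, hs, rfl⟩, hlt⟩ := exists_lt_of_csInf_lt
    (s := {c : ℝ | ∃ t : ℝ, susp t z = w ∧ c = |t|}) ⟨|t|, t, ht, rfl⟩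
    (lt_add_of_pos_right (vlen z w) hη)
  exact ⟨s, hs, hlt⟩

/-- Splitting the length of a basic path into its vertical part `v` and horizontal part `D`,
up to an error `η` per step; `N` is the number of crossings of the roof along the path. -/
theorem exists_shift_of_path (zs : ℕ → Sigma1 V E) (cs : ℕ → ℝ) {η : ℝ} (hη : 0 < η) (n : ℕ)
    (h : ∀ i < n, cs i ∈ stepCost (zs i) (zs (i + 1))) :
    ∃ (N : ℤ) (v D : ℝ), 0 ≤ v ∧ 0 ≤ D ∧ v + D ≤ ∑ i ∈ Finset.range n, cs i + n * η ∧
      |N + (zs n).1.2 - (zs 0).1.2| ≤ v ∧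
      (v < 1 / 4 → tmsDist (zs 0).1.1 (shiftZ (-N) (zs n).1.1) ≤ Real.exp 2 * D) := by
  induction n with
  | zero => exact ⟨0, 0, 0, le_rfl, le_rfl, by simp, by simp, by simp [shiftZ_zero, tmsDist_self]⟩
  | succ n ih =>
    obtain ⟨N, v, D, hv, hD, hvD, hN, hd⟩ := ih fun i hi => h i (by omega)
    have hstep := h n (Nat.lt_succ_self n)
    rw [Finset.sum_range_succ]
    push_cast
    rcases hstep with ⟨ht, hc⟩ | ⟨hex, hc⟩
    · have hl := hlen_nonneg (zs n) (zs (n + 1))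
      refine ⟨N, v, D + hlen (zs n) (zs (n + 1)), hv, by positivity, by linarith,
        by rw [← ht]; exact hN, fun hv4 => ?_⟩
      have hN1 : (-N).natAbs ≤ 1 := by
        have h0 := (zs 0).2
        have hn := (zs n).2
        obtain ⟨hl, hu⟩ := abs_le.1 hN
        have h2 : (N : ℝ) < 2 := by linarith
        have h3 : (-2 : ℝ) < N := by linarith
        have h2' : N < 2 := by exact_mod_cast h2
        have h3' : -2 < N := by exact_mod_cast h3
        omega
      have h1 := tmsDist_shiftZ_le_of_natAbs_le_one hN1 (zs n).1.1 (zs (n + 1)).1.1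
      have h2 := mul_le_mul_of_nonneg_left (tmsDist_le_exp_mul_hlen (zs n) (zs (n + 1)))
        (Real.exp_pos 1).le
      have h3 : Real.exp 1 * Real.exp 1 = Real.exp 2 := by
        rw [← Real.exp_add]
        norm_num
      rw [← mul_assoc, h3] at h2
      have h4 := tmsDist_triangle (zs 0).1.1 (shiftZ (-N) (zs n).1.1)
        (shiftZ (-N) (zs (n + 1)).1.1)
      linarith [hd hv4]
    · obtain ⟨τ, hτ, hlt⟩ := exists_abs_lt_vlen_add hex hη
      refine ⟨N + ⌊(zs n).1.2 + τ⌋, v + |τ|, D, by positivity, hD, by linarith, ?_,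
        fun hv4 => ?_⟩
      · rw [← hτ]
        have : ((N + ⌊(zs n).1.2 + τ⌋ : ℤ) : ℝ) + (susp τ (zs n)).1.2 - (zs 0).1.2
            = (N + (zs n).1.2 - (zs 0).1.2) + τ := by
          simp only [susp, Int.fract]
          push_cast
          ring
        rw [this]
        exact (abs_add_le _ _).trans (by linarith)
      · have : shiftZ (-(N + ⌊(zs n).1.2 + τ⌋)) (zs (n + 1)).1.1 = shiftZ (-N) (zs n).1.1 := by
          rw [← hτ]
          simp only [susp, shiftZ_shiftZ]
          congr 1
          ring
        rw [this]
        exact hd (by linarith [abs_nonneg τ])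

theorem pathCosts_nonempty (z w : Sigma1 V E) : (pathCosts z w).Nonempty := by
  let m : Sigma1 V E := ⟨(z.1.1, w.1.2), w.2⟩
  have hm : susp (w.1.2 - z.1.2) z = m := by
    apply Subtype.ext
    have h0 : ⌊w.1.2⌋ = 0 := Int.floor_eq_zero_iff.2 w.2
    have h1 : Int.fract w.1.2 = w.1.2 := Int.fract_eq_self.2 w.2
    simp [susp, m, h0, h1, shiftZ_zero]
  refine ⟨_, 2, fun i => if i = 0 then z else if i = 1 then m else w,
    fun i => if i = 0 then vlen z m else hlen m w, rfl, rfl, fun i hi => ?_, rfl⟩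
  interval_cases i
  · exact Or.inr ⟨⟨_, hm⟩, rfl⟩
  · exact Or.inl ⟨rfl, rfl⟩

theorem exists_shift_of_d1_lt {z w : Sigma1 V E} {B : ℝ} (hB : d1 z w < B) (hB4 : B < 1 / 4) :
    ∃ N : ℤ, |N + w.1.2 - z.1.2| ≤ B ∧
      tmsDist z.1.1 (shiftZ (-N) w.1.1) ≤ Real.exp 2 * B := by
  obtain ⟨c, ⟨n, zs, cs, h0, hn, hs, hc⟩, hcB⟩ :=
    exists_lt_of_csInf_lt (pathCosts_nonempty z w) hB
  have hη : 0 < (B - c) / (n + 1) := div_pos (by linarith) (by positivity)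
  obtain ⟨N, v, D, hv, hD, hvD, hN, hd⟩ := exists_shift_of_path zs cs hη n hs
  rw [h0, hn] at hN hd
  have hle : n * ((B - c) / (n + 1)) ≤ B - c := by
    have : (n + 1) * ((B - c) / (n + 1)) = B - c := by field_simp
    linarith
  rw [← hc] at hvD
  refine ⟨N, by linarith, (hd (by linarith)).trans ?_⟩
  gcongr
  linarith

theorem d1_nonneg (z w : Sigma1 V E) : 0 ≤ d1 z w := by
  refine Real.sInf_nonneg ?_
  rintro _ ⟨n, zs, cs, -, -, hs, rfl⟩
  refine Finset.sum_nonneg fun i hi => ?_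
  rcases hs i (Finset.mem_range.1 hi) with ⟨-, hc⟩ | ⟨-, hc⟩ <;> rw [hc]
  · exact hlen_nonneg _ _
  · refine Real.sInf_nonneg ?_
    rintro _ ⟨t, -, rfl⟩
    exact abs_nonneg t

theorem le_mul_of_forall_Ioo {L q f K : ℝ} (hL : L < q) (h : ∀ B, L < B → B < q → f ≤ K * B) :
    f ≤ K * L := by
  have ht : Tendsto (fun B => K * B) (𝓝[>] L) (𝓝 (K * L)) :=
    (continuous_const.mul continuous_id).continuousWithinAt
  refine ge_of_tendsto ht ?_
  filter_upwards [Ioo_mem_nhdsGT hL] with B hB using h B hB.1 hB.2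

theorem lower_bound_of_abs_sub_le_half {z w : Sigma1 V E} (hL : d1 z w < 1 / 4)
    (h : |z.1.2 - w.1.2| ≤ 1 / 2) :
    |z.1.2 - w.1.2| ≤ d1 z w ∧ tmsDist z.1.1 w.1.1 ≤ Real.exp 2 * d1 z w := by
  have key : ∀ B, d1 z w < B → B < 1 / 4 →
      |z.1.2 - w.1.2| ≤ B ∧ tmsDist z.1.1 w.1.1 ≤ Real.exp 2 * B := by
    intro B hB hB4
    obtain ⟨N, hN, hd⟩ := exists_shift_of_d1_lt hB hB4
    have hN0 : N = 0 := by
      obtain ⟨h1, h2⟩ := abs_le.1 hN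
      obtain ⟨h3, h4⟩ := abs_le.1 h
      have h5 : (N : ℝ) < 1 := by linarith
      have h6 : (-1 : ℝ) < N := by linarith
      have h5' : N < 1 := by exact_mod_cast h5
      have h6' : -1 < N := by exact_mod_cast h6
      omega
    subst hN0
    rw [neg_zero, shiftZ_zero] at hd
    rw [Int.cast_zero, zero_add, abs_sub_comm] at hN
    exact ⟨hN, hd⟩
  refine ⟨?_, le_mul_of_forall_Ioo hL fun B h1 h2 => (key B h1 h2).2⟩
  rw [← one_mul (d1 z w)]
  exact le_mul_of_forall_Ioo hL fun B h1 h2 => by rw [one_mul]; exact (key B h1 h2).1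

theorem lower_bound_of_half_lt_sub {z w : Sigma1 V E} (hL : d1 z w < 1 / 4)
    (h : 1 / 2 < z.1.2 - w.1.2) :
    1 + w.1.2 - z.1.2 ≤ d1 z w ∧ tmsDist (shiftZ 1 z.1.1) w.1.1 ≤ Real.exp 3 * d1 z w := by
  have key : ∀ B, d1 z w < B → B < 1 / 4 →
      1 + w.1.2 - z.1.2 ≤ B ∧ tmsDist (shiftZ 1 z.1.1) w.1.1 ≤ Real.exp 3 * B := by
    intro B hB hB4
    obtain ⟨N, hN, hd⟩ := exists_shift_of_d1_lt hB hB4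
    obtain ⟨h1, h2⟩ := abs_le.1 hN
    have hN1 : N = 1 := by
      have hz := z.2
      have hw := w.2
      have h5 : (N : ℝ) < 2 := by linarith
      have h6 : (0 : ℝ) < N := by linarith
      have h5' : N < 2 := by exact_mod_cast h5
      have h6' : 0 < N := by exact_mod_cast h6
      omega
    subst hN1
    refine ⟨by push_cast at h2; exact h2, ?_⟩
    have h3 := tmsDist_shiftZ_le_of_natAbs_le_one (k := 1) le_rfl z.1.1 (shiftZ (-1) w.1.1)
    rw [shiftZ_shiftZ, add_neg_cancel, shiftZ_zero] at h3
    have h4 : Real.exp 3 = Real.exp 1 * Real.exp 2 := by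
      rw [← Real.exp_add]
      norm_num
    rw [h4, mul_assoc]
    exact h3.trans (mul_le_mul_of_nonneg_left hd (Real.exp_pos 1).le)
  refine ⟨?_, le_mul_of_forall_Ioo hL fun B h1 h2 => (key B h1 h2).2⟩
  rw [← one_mul (d1 z w)]
  exact le_mul_of_forall_Ioo hL fun B h1 h2 => by rw [one_mul]; exact (key B h1 h2).1

theorem thetaR_fst {r : TMS V E → ℝ} {z : SigmaR V E r} (h : 0 < r z.1.1) :
    (thetaR r z).1.1 = z.1.1 := by
  simp [thetaR, h]

theorem thetaR_snd {r : TMS V E → ℝ} {z : SigmaR V E r} (h : 0 < r z.1.1) :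
    (thetaR r z).1.2 = z.1.2 / r z.1.1 := by
  simp [thetaR, h]

end BowenWalters

/-- lower bounds for the Bowen–Walters distance. -/
theorem stmt16 (V : Type) (E : V → V → Prop)
    (hin : ∀ v, ∃ u, E u v) (hout : ∀ v, ∃ w, E v w)
    (r : TMS V E → ℝ) (a b H α : ℝ) (ha : 0 < a) (hab : ∀ x, a ≤ r x ∧ r x ≤ b)
    (hH : 0 < H) (hα : 0 < α) (hα1 : α ≤ 1)
    (hHol : ∀ x y : TMS V E, |r x - r y| ≤ H * tmsDist x y ^ α) :
    ∃ C₂ κ : ℝ, 0 < C₂ ∧ 0 < κ ∧ κ < 1 ∧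
      ∀ z w : SigmaR V E r,
        (|z.1.2 / r z.1.1 - w.1.2 / r w.1.1| ≤ 1 / 2 →
          tmsDist z.1.1 w.1.1 ≤ C₂ * dr r z w ∧
          |w.1.2 - z.1.2| ≤ C₂ * dr r z w ^ κ) ∧
        (z.1.2 / r z.1.1 - w.1.2 / r w.1.1 > 1 / 2 →
          tmsDist (shiftZ 1 z.1.1) w.1.1 ≤ C₂ * dr r z w ∧
          |z.1.2 - r z.1.1| ≤ C₂ * dr r z w ∧ w.1.2 ≤ C₂ * dr r z w) := by
  set A := Real.exp 3
  have hA4 : 4 ≤ A := by linarith [Real.add_one_le_exp (3 : ℝ)]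
  have hAα : 0 < A ^ α := Real.rpow_pos_of_pos (by linarith) α
  have hHA : 0 < H * A ^ α := mul_pos hH hAα
  have hb0 := abs_nonneg b
  refine ⟨4 * |b| + H * A ^ α + A, α / 2, by linarith, by linarith, by linarith, ?_⟩
  intro z w
  have hrz : 0 < r z.1.1 := ha.trans_le (hab _).1
  have hrw : 0 < r w.1.1 := ha.trans_le (hab _).1
  have hbz : r z.1.1 ≤ |b| := (hab _).2.trans (le_abs_self b)
  have hbw : r w.1.1 ≤ |b| := (hab _).2.trans (le_abs_self b)
  have hz := z.2
  have hw := w.2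
  have hzx := thetaR_fst hrz
  have hzt := thetaR_snd hrz
  have hwx := thetaR_fst hrw
  have hwt := thetaR_snd hrw
  have hL0 : 0 ≤ dr r z w := d1_nonneg _ _
  have hLdef : d1 (thetaR r z) (thetaR r w) = dr r z w := rfl
  have hs : w.1.2 = w.1.2 / r w.1.1 * r w.1.1 := by field_simp
  have hs0 : 0 ≤ w.1.2 / r w.1.1 := div_nonneg hw.1 hrw.le
  have ht1 : z.1.2 / r z.1.1 ≤ 1 := (div_le_one hrz).2 hz.2.le
  set L := dr r z w
  have hbL : 0 ≤ |b| * L := mul_nonneg hb0 hL0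
  have hHL : 0 ≤ H * A ^ α * L := mul_nonneg hHA.le hL0
  have hAL : 0 ≤ A * L := mul_nonneg (by linarith) hL0
  rcases lt_or_ge L (1 / 4) with hL | hL
  · constructor
    · intro h
      rw [← hzt, ← hwt] at h
      obtain ⟨h1, h2⟩ := lower_bound_of_abs_sub_le_half (by rw [hLdef]; exact hL) h
      rw [hzt, hwt, hLdef] at h1
      rw [hzx, hwx, hLdef] at h2
      have h3 : tmsDist z.1.1 w.1.1 ≤ A * L :=
        h2.trans (mul_le_mul_of_nonneg_right (Real.exp_le_exp.2 (by norm_num)) hL0)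
      refine ⟨by linarith, ?_⟩
      have hLκ : L ≤ L ^ (α / 2) :=
        Real.self_le_rpow_of_le_one hL0 (by linarith) (by linarith)
      have hLα : L ^ α ≤ L ^ (α / 2) :=
        Real.rpow_le_rpow_of_exponent_ge' hL0 (by linarith) (by linarith) (by linarith)
      have hκ0 : 0 ≤ L ^ (α / 2) := Real.rpow_nonneg hL0 _
      have h4 : |r w.1.1 - r z.1.1| ≤ H * A ^ α * L ^ (α / 2) := by
        rw [abs_sub_comm]
        calc |r z.1.1 - r w.1.1| ≤ H * tmsDist z.1.1 w.1.1 ^ α := hHol _ _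
          _ ≤ H * (A * L) ^ α := by
            gcongr
            exact tmsDist_nonneg _ _
          _ = H * A ^ α * L ^ α := by
            rw [Real.mul_rpow (by linarith) hL0, mul_assoc]
          _ ≤ _ := by gcongr
      have h5 : w.1.2 - z.1.2 = (w.1.2 / r w.1.1 - z.1.2 / r z.1.1) * r w.1.1 +
          z.1.2 / r z.1.1 * (r w.1.1 - r z.1.1) := by
        field_simp
        ring
      have h6 : |(w.1.2 / r w.1.1 - z.1.2 / r z.1.1) * r w.1.1| ≤ L ^ (α / 2) * |b| := by
        rw [abs_mul, abs_of_pos hrw, abs_sub_comm]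
        gcongr
        exact h1.trans hLκ
      have h7 : |z.1.2 / r z.1.1 * (r w.1.1 - r z.1.1)| ≤ H * A ^ α * L ^ (α / 2) := by
        rw [abs_mul, abs_of_nonneg (div_nonneg hz.1 hrz.le)]
        exact (mul_le_of_le_one_left (abs_nonneg _) ht1).trans h4
      have h8 : 0 ≤ A * L ^ (α / 2) := mul_nonneg (by linarith) hκ0
      have h9 : 0 ≤ |b| * L ^ (α / 2) := mul_nonneg hb0 hκ0
      rw [h5]
      exact (abs_add_le _ _).trans (by linarith)
    · intro h
      rw [← hzt, ← hwt] at h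
      obtain ⟨h1, h2⟩ := lower_bound_of_half_lt_sub (by rw [hLdef]; exact hL) h
      rw [hzt, hwt, hLdef] at h1
      rw [hzx, hwx, hLdef] at h2
      refine ⟨by linarith, ?_, ?_⟩
      · rw [abs_sub_comm, abs_of_nonneg (by linarith)]
        have h3 : r z.1.1 - z.1.2 = (1 - z.1.2 / r z.1.1) * r z.1.1 := by
          field_simp
        have h4 : (1 - z.1.2 / r z.1.1) * r z.1.1 ≤ L * |b| := by
          gcongr
          linarith
        linarith
      · have h3 : w.1.2 / r w.1.1 * r w.1.1 ≤ L * |b| := by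
          gcongr
          linarith
        linarith
  · have hb4 : |b| ≤ 4 * |b| * L := by
      have := mul_le_mul_of_nonneg_left hL hb0
      linarith
    have hA1 : 1 ≤ A * L := by
      have := mul_le_mul hA4 hL (by norm_num) (by linarith)
      linarith
    refine ⟨fun _ => ⟨by linarith [tmsDist_le_one z.1.1 w.1.1], ?_⟩, fun _ =>
      ⟨by linarith [tmsDist_le_one (shiftZ 1 z.1.1) w.1.1], ?_, by linarith⟩⟩
    · have hκ : 1 / 4 ≤ L ^ (α / 2) :=
        calc (1 / 4 : ℝ) ≤ (1 / 4) ^ (α / 2) :=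
              Real.self_le_rpow_of_le_one (by norm_num) (by norm_num) (by linarith)
          _ ≤ L ^ (α / 2) := by gcongr
      have h1 := mul_le_mul_of_nonneg_left hκ hb0
      have h2 : 0 ≤ (H * A ^ α + A) * L ^ (α / 2) := mul_nonneg (by linarith) (by linarith)
      have h3 : |w.1.2 - z.1.2| ≤ |b| := abs_le.2 ⟨by linarith, by linarith⟩
      linarith
    · rw [abs_sub_comm, abs_of_nonneg (by linarith)]
      linarith
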